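/- arXiv:1403.1616 — 2 statements merged into one kernel-verified Lean document; each statement's English description precedes it below -/
import Mathlib

section
/- For every n ≥ 3, the prism Pr_n is 3-word-representable but not 2-word-representable; consequently, the representation number R(Pr_n) equals 3. -/
/-- Two letters `x` and `y` alternate in the word `w` if, after deleting all letters
other than `x` and `y`, no two equal letters are consecutive. -/
def Alternate {V : Type*} [DecidableEq V] (w : List V) (x y : V) : Prop :=
  (w.filter (fun z => decide (z = x ∨ z = y))).Chain' (· ≠ ·)

/-- A word `w` represents the graph `G` if every vertex occurs in `w` and two distinct
vertices alternate in `w` exactly when they are adjacent in `G`. -/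
def Represents {V : Type*} [DecidableEq V] (w : List V) (G : SimpleGraph V) : Prop :=
  (∀ v : V, v ∈ w) ∧ ∀ x y : V, x ≠ y → (Alternate w x y ↔ G.Adj x y)

/-- A graph is word-representable if some word represents it. -/
def WordRepresentable {V : Type*} [DecidableEq V] (G : SimpleGraph V) : Prop :=
  ∃ w : List V, Represents w G

/-- A word is `k`-uniform if every letter occurs in it exactly `k` times. -/
def KUniform {V : Type*} [DecidableEq V] (k : ℕ) (w : List V) : Prop :=
  ∀ v : V, w.count v = k

/-- A graph is `k`-word-representable if some `k`-uniform word represents it. -/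
def KRepresentable {V : Type*} [DecidableEq V] (G : SimpleGraph V) (k : ℕ) : Prop :=
  ∃ w : List V, KUniform k w ∧ Represents w G

/-- The representation number of a graph: the least `k` such that it is
`k`-word-representable. -/
noncomputable def reprNum {V : Type*} [DecidableEq V] (G : SimpleGraph V) : ℕ :=
  sInf {k | KRepresentable G k}

/-- The prism `Pr n`: two `n`-cycles `1-2-⋯-n-1` and `1'-2'-⋯-n'-1'` together with the
rungs `(i, i')`. Vertices `Sum.inl i` are the unprimed ones, `Sum.inr i` the primed ones. -/
def prism (n : ℕ) : SimpleGraph (Fin n ⊕ Fin n) :=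
  SimpleGraph.fromRel (fun a b =>
    match a, b with
    | Sum.inl i, Sum.inl j => (j : ℕ) = ((i : ℕ) + 1) % n
    | Sum.inr i, Sum.inr j => (j : ℕ) = ((i : ℕ) + 1) % n
    | Sum.inl i, Sum.inr j => i = j
    | _, _ => False)

/-- A word spelled out by `f` along a strictly increasing list of positions has no two equal
consecutive letters iff any two positions with equal letters are separated by another one. -/
theorem isChain_map_ne_iff {V : Type*} (f : ℕ → V) :
    ∀ l : List ℕ, l.Pairwise (· < ·) →
      ((l.map f).IsChain (· ≠ ·) ↔
        ∀ s ∈ l, ∀ t ∈ l, s < t → f s = f t → ∃ r ∈ l, s < r ∧ r < t)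
  | [], _ => by simp
  | [a], _ => by simp
  | a :: b :: l, h => by
    have hb := h.tail
    have ih := isChain_map_ne_iff f (b :: l) hb
    rw [List.map_cons, List.map_cons, List.isChain_cons_cons, ← List.map_cons, ih]
    have hab : ∀ x ∈ b :: l, a < x := (List.pairwise_cons.1 h).1
    have hbl : ∀ x ∈ l, b < x := (List.pairwise_cons.1 hb).1
    constructor
    · rintro ⟨hne, H⟩ s hs t ht hst heq
      rcases List.mem_cons.1 ht with rfl | htl
      · rcases List.mem_cons.1 hs with rfl | hs
        · omega
        · have := hab s hs; omega
      rcases List.mem_cons.1 hs with rfl | hs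
      · rcases List.mem_cons.1 htl with rfl | ht'
        · exact absurd heq hne
        · exact ⟨b, by simp, hab b (by simp), hbl t ht'⟩
      · obtain ⟨r, hr, h1, h2⟩ := H s hs t htl hst heq
        exact ⟨r, List.mem_cons_of_mem _ hr, h1, h2⟩
    · intro H
      refine ⟨fun heq => ?_, fun s hs t ht hst heq => ?_⟩
      · obtain ⟨r, hr, h1, h2⟩ := H a (by simp) b (by simp) (hab b (by simp)) heq
        rcases List.mem_cons.1 hr with rfl | hr
        · omega
        rcases List.mem_cons.1 hr with rfl | hr
        · omega
        · have := hbl r hr; omega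
      · obtain ⟨r, hr, h1, h2⟩ :=
          H s (List.mem_cons_of_mem _ hs) t (List.mem_cons_of_mem _ ht) hst heq
        rcases List.mem_cons.1 hr with rfl | hr
        · have := hab s hs; omega
        · exact ⟨r, hr, h1, h2⟩

theorem alternate_map_range_iff {V : Type*} [DecidableEq V] (f : ℕ → V) (N : ℕ) (x y : V) :
    Alternate ((List.range N).map f) x y ↔
      ∀ s < N, ∀ t < N, (f s = x ∨ f s = y) → s < t → f s = f t →
        ∃ r, (f r = x ∨ f r = y) ∧ s < r ∧ r < t := by
  unfold Alternate
  rw [List.filter_map]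
  refine (isChain_map_ne_iff f _ (List.Pairwise.filter _ List.pairwise_lt_range)).trans ?_
  simp only [List.mem_filter, List.mem_range, Function.comp_apply, decide_eq_true_eq]
  constructor
  · intro H s hs t ht hx hst heq
    obtain ⟨r, ⟨_, hr⟩, h1, h2⟩ := H s ⟨hs, hx⟩ t ⟨ht, heq ▸ hx⟩ hst heq
    exact ⟨r, hr, h1, h2⟩
  · rintro H s ⟨hs, hx⟩ t ⟨ht, _⟩ hst heq
    obtain ⟨r, hr, h1, h2⟩ := H s hs t ht hx hst heq
    exact ⟨r, ⟨by omega, hr⟩, h1, h2⟩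

/-- `p` and `q` are the only positions below `N` carrying the letter `x`, in this order. -/
def OccursAtTwo {V : Type*} (f : ℕ → V) (N : ℕ) (x : V) (p q : ℕ) : Prop :=
  p < q ∧ q < N ∧ ∀ s < N, f s = x ↔ s = p ∨ s = q

/-- `p`, `q` and `r` are the only positions below `N` carrying the letter `x`, in this order. -/
def OccursAtThree {V : Type*} (f : ℕ → V) (N : ℕ) (x : V) (p q r : ℕ) : Prop :=
  p < q ∧ q < r ∧ r < N ∧ ∀ s < N, f s = x ↔ s = p ∨ s = q ∨ s = r

theorem alternate_iff_of_occursAtTwo {V : Type*} [DecidableEq V] {f : ℕ → V} {N : ℕ} {x y : V}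
    (hxy : x ≠ y) {p₁ p₂ q₁ q₂ : ℕ} (hp : OccursAtTwo f N x p₁ p₂)
    (hq : OccursAtTwo f N y q₁ q₂) :
    Alternate ((List.range N).map f) x y ↔
      (p₁ < q₁ ∧ q₁ < p₂ ∧ p₂ < q₂) ∨ (q₁ < p₁ ∧ p₁ < q₂ ∧ q₂ < p₂) := by
  rw [alternate_map_range_iff]
  obtain ⟨hp1, hp2, hp⟩ := hp
  obtain ⟨hq1, hq2, hq⟩ := hq
  have fp1 : f p₁ = x := (hp _ (by omega)).2 (by simp)
  have fp2 : f p₂ = x := (hp _ (by omega)).2 (by simp)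
  have fq1 : f q₁ = y := (hq _ (by omega)).2 (by simp)
  have fq2 : f q₂ = y := (hq _ (by omega)).2 (by simp)
  have dis : ∀ {s t}, f s = x → f t = y → s ≠ t := by
    rintro s t h1 h2 rfl
    exact hxy (h1.symm.trans h2)
  have d1 := dis fp1 fq1
  have d2 := dis fp1 fq2
  have d3 := dis fp2 fq1
  have d4 := dis fp2 fq2
  constructor
  · intro H
    obtain ⟨r, hr, h1, h2⟩ := H p₁ (by omega) p₂ (by omega) (by simp [fp1]) (by omega)
      (by rw [fp1, fp2])
    obtain ⟨s, hs, h3, h4⟩ := H q₁ (by omega) q₂ (by omega) (by simp [fq1]) (by omega)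
      (by rw [fq1, fq2])
    rw [hp _ (by omega), hq _ (by omega)] at hr hs
    omega
  · intro H s hs t ht hst hlt heq
    rcases hst with h | h
    · have h' := heq.symm.trans h
      rw [hp _ (by omega)] at h h'
      rcases H with H | H
      · exact ⟨q₁, .inr fq1, by omega, by omega⟩
      · exact ⟨q₂, .inr fq2, by omega, by omega⟩
    · have h' := heq.symm.trans h
      rw [hq _ (by omega)] at h h'
      rcases H with H | H
      · exact ⟨p₂, .inl fp2, by omega, by omega⟩
      · exact ⟨p₁, .inl fp1, by omega, by omega⟩

theorem alternate_iff_of_occursAtThree {V : Type*} [DecidableEq V] {f : ℕ → V} {N : ℕ} {x y : V}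
    (hxy : x ≠ y) {p₁ p₂ p₃ q₁ q₂ q₃ : ℕ} (hp : OccursAtThree f N x p₁ p₂ p₃)
    (hq : OccursAtThree f N y q₁ q₂ q₃) :
    Alternate ((List.range N).map f) x y ↔
      (p₁ < q₁ ∧ q₁ < p₂ ∧ p₂ < q₂ ∧ q₂ < p₃ ∧ p₃ < q₃) ∨
        (q₁ < p₁ ∧ p₁ < q₂ ∧ q₂ < p₂ ∧ p₂ < q₃ ∧ q₃ < p₃) := by
  rw [alternate_map_range_iff]
  obtain ⟨hp1, hp2, hp3, hp⟩ := hp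
  obtain ⟨hq1, hq2, hq3, hq⟩ := hq
  have fp1 : f p₁ = x := (hp _ (by omega)).2 (by simp)
  have fp2 : f p₂ = x := (hp _ (by omega)).2 (by simp)
  have fp3 : f p₃ = x := (hp _ (by omega)).2 (by simp)
  have fq1 : f q₁ = y := (hq _ (by omega)).2 (by simp)
  have fq2 : f q₂ = y := (hq _ (by omega)).2 (by simp)
  have fq3 : f q₃ = y := (hq _ (by omega)).2 (by simp)
  constructor
  · intro H
    have dis : ∀ {s t}, f s = x → f t = y → s ≠ t := by
      rintro s t h1 h2 rfl
      exact hxy (h1.symm.trans h2)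
    have d1 := dis fp1 fq1
    have d2 := dis fp3 fq3
    obtain ⟨r, hr, h1, h2⟩ := H p₁ (by omega) p₂ (by omega) (by simp [fp1]) (by omega)
      (by rw [fp1, fp2])
    obtain ⟨s, hs, h3, h4⟩ := H p₂ (by omega) p₃ (by omega) (by simp [fp2]) (by omega)
      (by rw [fp2, fp3])
    obtain ⟨t, ht, h5, h6⟩ := H q₁ (by omega) q₂ (by omega) (by simp [fq1]) (by omega)
      (by rw [fq1, fq2])
    obtain ⟨u, hu, h7, h8⟩ := H q₂ (by omega) q₃ (by omega) (by simp [fq2]) (by omega)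
      (by rw [fq2, fq3])
    rw [hp _ (by omega), hq _ (by omega)] at hr hs ht hu
    replace hr : r = q₁ ∨ r = q₂ ∨ r = q₃ := by omega
    replace hs : s = q₁ ∨ s = q₂ ∨ s = q₃ := by omega
    replace ht : t = p₁ ∨ t = p₂ ∨ t = p₃ := by omega
    replace hu : u = p₁ ∨ u = p₂ ∨ u = p₃ := by omega
    rcases hr with rfl | rfl | rfl <;> rcases hs with rfl | rfl | rfl <;> omega
  · intro H s hs t ht hst hlt heq
    rcases hst with h | h
    · have h' := heq.symm.trans h
      rw [hp _ (by omega)] at h h'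
      rcases H with H | H
      · rcases h with rfl | rfl | rfl
        · exact ⟨q₁, .inr fq1, by omega, by omega⟩
        · exact ⟨q₂, .inr fq2, by omega, by omega⟩
        · omega
      · rcases h with rfl | rfl | rfl
        · exact ⟨q₂, .inr fq2, by omega, by omega⟩
        · exact ⟨q₃, .inr fq3, by omega, by omega⟩
        · omega
    · have h' := heq.symm.trans h
      rw [hq _ (by omega)] at h h'
      rcases H with H | H
      · rcases h with rfl | rfl | rfl
        · exact ⟨p₂, .inl fp2, by omega, by omega⟩
        · exact ⟨p₃, .inl fp3, by omega, by omega⟩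
        · omega
      · rcases h with rfl | rfl | rfl
        · exact ⟨p₁, .inl fp1, by omega, by omega⟩
        · exact ⟨p₂, .inl fp2, by omega, by omega⟩
        · omega

theorem count_map_range {V : Type*} [DecidableEq V] (f : ℕ → V) (N : ℕ) (v : V) :
    ((List.range N).map f).count v = ((Finset.range N).filter (f · = v)).card := by
  rw [List.count, List.countP_map, List.countP_eq_length_filter,
    ← List.toFinset_card_of_nodup (List.nodup_range.filter _)]
  congr 1
  ext s
  simp

theorem exists_occursAtTwo {V : Type*} [DecidableEq V] {f : ℕ → V} {N : ℕ} {v : V}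
    (h : ((List.range N).map f).count v = 2) : ∃ p q, OccursAtTwo f N v p q := by
  rw [count_map_range, Finset.card_eq_two] at h
  obtain ⟨p, q, hpq, h⟩ := h
  have H : ∀ s, (s < N ∧ f s = v) ↔ s = p ∨ s = q := fun s => by
    simpa using congrArg (s ∈ ·) h
  have hp := ((H p).2 (by simp)).1
  have hq := ((H q).2 (by simp)).1
  rcases Nat.lt_or_gt_of_ne hpq with h | h
  · exact ⟨p, q, h, hq, fun s hs => by rw [← H]; simp [hs]⟩
  · exact ⟨q, p, h, hp, fun s hs => by rw [or_comm, ← H]; simp [hs]⟩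

theorem OccursAtThree.count_eq {V : Type*} [DecidableEq V] {f : ℕ → V} {N : ℕ} {v : V}
    {p q r : ℕ} (h : OccursAtThree f N v p q r) : ((List.range N).map f).count v = 3 := by
  rw [count_map_range, Finset.card_eq_three]
  obtain ⟨h1, h2, h3, h⟩ := h
  refine ⟨p, q, r, by omega, by omega, by omega, ?_⟩
  ext s
  simp only [Finset.mem_filter, Finset.mem_range, Finset.mem_insert, Finset.mem_singleton]
  constructor
  · rintro ⟨hs, hv⟩
    exact (h s hs).1 hv
  · intro hs
    have hN : s < N := by omega
    exact ⟨hN, (h s hN).2 hs⟩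

theorem not_kRepresentable_zero {V : Type*} [DecidableEq V] [Nonempty V] (G : SimpleGraph V) :
    ¬ KRepresentable G 0 := by
  rintro ⟨w, hw, h, -⟩
  obtain ⟨v⟩ := ‹Nonempty V›
  exact List.count_eq_zero.1 (hw v) (h v)

theorem eq_top_of_kRepresentable_one {V : Type*} [DecidableEq V] {G : SimpleGraph V}
    (hG : KRepresentable G 1) : G = ⊤ := by
  obtain ⟨w, hw, -, h⟩ := hG
  ext x y
  refine ⟨fun h => h.ne, fun hxy => (h x y hxy).1 ?_⟩
  have hnd : w.Nodup := List.nodup_iff_count_le_one.2 fun v => (hw v).le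
  exact (hnd.filter _).isChain

/-- Two indices are neighbours on the cycle `0 - 1 - ⋯ - (n-1) - 0`. -/
def CycleAdj {n : ℕ} (i j : Fin n) : Prop :=
  (i : ℕ) + 1 = j ∨ (j : ℕ) + 1 = i ∨ ((i : ℕ) = 0 ∧ (j : ℕ) + 1 = n) ∨
    ((j : ℕ) = 0 ∧ (i : ℕ) + 1 = n)

theorem succ_mod_eq_ite {n : ℕ} (i : Fin n) :
    ((i : ℕ) + 1) % n = if (i : ℕ) + 1 = n then 0 else (i : ℕ) + 1 := by
  split_ifs with h
  · simp [h]
  · exact Nat.mod_eq_of_lt (by omega)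

theorem cycleAdj_iff {n : ℕ} (hn : 3 ≤ n) (i j : Fin n) :
    (i ≠ j ∧ ((j : ℕ) = ((i : ℕ) + 1) % n ∨ (i : ℕ) = ((j : ℕ) + 1) % n)) ↔ CycleAdj i j := by
  rw [succ_mod_eq_ite, succ_mod_eq_ite, ne_eq, Fin.ext_iff, CycleAdj]
  split_ifs <;> omega

theorem prism_adj_inl_inl {n : ℕ} (hn : 3 ≤ n) (i j : Fin n) :
    (prism n).Adj (.inl i) (.inl j) ↔ CycleAdj i j := by
  simp [prism, ← cycleAdj_iff hn]

theorem prism_adj_inr_inr {n : ℕ} (hn : 3 ≤ n) (i j : Fin n) :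
    (prism n).Adj (.inr i) (.inr j) ↔ CycleAdj i j := by
  simp [prism, ← cycleAdj_iff hn]

theorem prism_adj_inl_inr {n : ℕ} (i j : Fin n) :
    (prism n).Adj (.inl i) (.inr j) ↔ i = j := by
  simp [prism]

theorem prism_adj_inr_inl {n : ℕ} (i j : Fin n) :
    (prism n).Adj (.inr i) (.inl j) ↔ i = j := by
  simp [prism, eq_comm]

theorem prism_triangleFree {n : ℕ} (hn : 4 ≤ n) {u v w : Fin n ⊕ Fin n}
    (huv : (prism n).Adj u v) (huw : (prism n).Adj u w) (hvw : (prism n).Adj v w) : False := by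
  have hn' : 3 ≤ n := by omega
  rcases u with i | i <;> rcases v with j | j <;> rcases w with k | k <;>
    simp only [prism_adj_inl_inl hn', prism_adj_inr_inr hn', prism_adj_inl_inr,
      prism_adj_inr_inl, CycleAdj, Fin.ext_iff] at huv huw hvw <;> omega

/-- A cycle with one vertex removed is connected. -/
theorem constant_off_of_cycleAdj {n : ℕ} (hn : 3 ≤ n) (i : Fin n) (c : Fin n → ℕ)
    (h : ∀ j k, j ≠ i → k ≠ i → CycleAdj j k → c j = c k) : ∃ c₀, ∀ j, j ≠ i → c j = c₀ := by
  let g : ∀ k, k < n → Fin n := fun k hk =>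
    ⟨if (i : ℕ) + k < n then i + k else i + k - n, by split_ifs <;> omega⟩
  have key : ∀ k (hk : k + 1 < n), c (g (k + 1) hk) = c (g 1 (by omega)) := by
    intro k
    induction k with
    | zero => intro _; rfl
    | succ k ih =>
      intro hk
      rw [← ih (by omega)]
      apply h
      · simp only [g, ne_eq, Fin.ext_iff]; split_ifs <;> omega
      · simp only [g, ne_eq, Fin.ext_iff]; split_ifs <;> omega
      · simp only [g, CycleAdj]; split_ifs <;> omega
  refine ⟨c (g 1 (by omega)), fun j hj => ?_⟩
  rw [ne_eq, Fin.ext_iff] at hj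
  by_cases hij : (i : ℕ) < j
  · rw [← key (j - i - 1) (by omega)]
    congr 1
    simp only [g, Fin.ext_iff]; split_ifs <;> omega
  · rw [← key (j + n - i - 1) (by omega)]
    congr 1
    simp only [g, Fin.ext_iff]; split_ifs <;> omega

/-- The subgraph of the prism induced by the non-neighbours of a vertex is connected. -/
theorem prism_constant_off_neighbors {n : ℕ} (hn : 3 ≤ n) (v : Fin n ⊕ Fin n)
    (c : Fin n ⊕ Fin n → ℕ)
    (h : ∀ x y, x ≠ v → y ≠ v → ¬ (prism n).Adj v x → ¬ (prism n).Adj v y →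
      (prism n).Adj x y → c x = c y) :
    ∃ c₀, ∀ x, x ≠ v → ¬ (prism n).Adj v x → c x = c₀ := by
  rcases v with i | i
  · obtain ⟨c₀, hc⟩ := constant_off_of_cycleAdj hn i (fun j => c (.inr j)) fun j k hj hk hjk =>
      h _ _ (by simp) (by simp) (by rwa [prism_adj_inl_inr, eq_comm])
        (by rwa [prism_adj_inl_inr, eq_comm]) (by rwa [prism_adj_inr_inr hn])
    refine ⟨c₀, fun x hx hvx => ?_⟩
    rcases x with j | j
    · have hj : j ≠ i := by simpa using hx
      rw [← hc j hj]
      exact h _ _ hx (by simp) hvx (by rwa [prism_adj_inl_inr, eq_comm])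
        (by rw [prism_adj_inl_inr])
    · exact hc j (by rwa [prism_adj_inl_inr, eq_comm] at hvx)
  · obtain ⟨c₀, hc⟩ := constant_off_of_cycleAdj hn i (fun j => c (.inl j)) fun j k hj hk hjk =>
      h _ _ (by simp) (by simp) (by rwa [prism_adj_inr_inl, eq_comm])
        (by rwa [prism_adj_inr_inl, eq_comm]) (by rwa [prism_adj_inl_inl hn])
    refine ⟨c₀, fun x hx hvx => ?_⟩
    rcases x with j | j
    · exact hc j (by rwa [prism_adj_inr_inl, eq_comm] at hvx)
    · have hj : j ≠ i := by simpa using hx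
      rw [← hc j hj]
      exact h _ _ hx (by simp) hvx (by rwa [prism_adj_inr_inl, eq_comm])
        (by rw [prism_adj_inr_inl])

open Classical in
theorem card_filter_cycleAdj {n : ℕ} (hn : 3 ≤ n) (i : Fin n) :
    (Finset.univ.filter (CycleAdj i)).card = 2 := by
  rw [Finset.card_eq_two]
  refine ⟨⟨if (i : ℕ) + 1 = n then 0 else i + 1, by split_ifs <;> omega⟩,
    ⟨if (i : ℕ) = 0 then n - 1 else i - 1, by split_ifs <;> omega⟩, ?_, ?_⟩
  · simp only [ne_eq, Fin.ext_iff]; split_ifs <;> omega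
  · ext j
    simp only [Finset.mem_filter, Finset.mem_univ, true_and, Finset.mem_insert,
      Finset.mem_singleton, Fin.ext_iff, CycleAdj]
    split_ifs <;> omega

open Classical in
theorem prism_card_neighbors {n : ℕ} (hn : 3 ≤ n) (v : Fin n ⊕ Fin n) :
    (Finset.univ.filter ((prism n).Adj v)).card = 3 := by
  rw [Finset.card_filter, Fintype.sum_sum_type]
  rcases v with i | i <;>
    simp only [prism_adj_inl_inl hn, prism_adj_inr_inr hn, prism_adj_inl_inr,
      prism_adj_inr_inl, ← Finset.card_filter, card_filter_cycleAdj hn] <;>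
    simp [Finset.filter_eq]

/-- The positions of the letters in a `2`-uniform word `f 0, …, f (4 * n - 1)` representing the
prism: `x` occurs at `a x` and at `b x`. -/
structure IsPrismTwoWord (n : ℕ) (f : ℕ → Fin n ⊕ Fin n) (a b : Fin n ⊕ Fin n → ℕ) : Prop where
  occurs : ∀ x, OccursAtTwo f (4 * n) x (a x) (b x)
  adj_iff : ∀ x y, x ≠ y → ((prism n).Adj x y ↔
    (a x < a y ∧ a y < b x ∧ b x < b y) ∨ (a y < a x ∧ a x < b y ∧ b y < b x))

theorem exists_isPrismTwoWord {n : ℕ} (hn : 3 ≤ n) (h : KRepresentable (prism n) 2) :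
    ∃ f a b, IsPrismTwoWord n f a b := by
  obtain ⟨w, hw, -, h⟩ := h
  have hlen : w.length = 4 * n := by
    rw [← Multiset.coe_card, ← Multiset.sum_count_eq_card (s := Finset.univ) (by simp)]
    simp only [Multiset.coe_count, hw _]
    simp
    omega
  let f : ℕ → Fin n ⊕ Fin n := fun s => w.getD s (.inl ⟨0, by omega⟩)
  have hf : (List.range (4 * n)).map f = w := by
    apply List.ext_getElem
    · simp [hlen]
    · intro i h1 h2
      simp [f, h2]
  choose a b hab using fun v => exists_occursAtTwo (f := f) (N := 4 * n) (v := v) (by rw [hf, hw])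
  refine ⟨f, a, b, hab, fun x y hxy => ?_⟩
  rw [← h x y hxy, ← hf, alternate_iff_of_occursAtTwo hxy (hab x) (hab y)]

namespace IsPrismTwoWord

variable {n : ℕ} {f : ℕ → Fin n ⊕ Fin n} {a b : Fin n ⊕ Fin n → ℕ}

theorem letter_a (h : IsPrismTwoWord n f a b) (x) : f (a x) = x := by
  obtain ⟨h1, h2, h3⟩ := h.occurs x
  exact (h3 _ (by omega)).2 (by simp)

theorem letter_b (h : IsPrismTwoWord n f a b) (x) : f (b x) = x := by
  obtain ⟨h1, h2, h3⟩ := h.occurs x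
  exact (h3 _ (by omega)).2 (by simp)

theorem positions_ne (h : IsPrismTwoWord n f a b) {x y} (hxy : x ≠ y) :
    a x ≠ a y ∧ a x ≠ b y ∧ b x ≠ a y ∧ b x ≠ b y := by
  have key : ∀ {s t}, f s = x → f t = y → s ≠ t := by
    rintro s t h1 h2 rfl
    exact hxy (h1.symm.trans h2)
  exact ⟨key (h.letter_a x) (h.letter_a y), key (h.letter_a x) (h.letter_b y),
    key (h.letter_b x) (h.letter_a y), key (h.letter_b x) (h.letter_b y)⟩

theorem card_between (h : IsPrismTwoWord n f a b) (v x) :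
    ((Finset.Ioo (a v) (b v)).filter (f · = x)).card =
      (if a v < a x ∧ a x < b v then 1 else 0) + (if a v < b x ∧ b x < b v then 1 else 0) := by
  obtain ⟨h1, h2, h3⟩ := h.occurs x
  have hv := (h.occurs v).2.1
  have : (Finset.Ioo (a v) (b v)).filter (f · = x) =
      ({a x, b x} : Finset ℕ).filter (fun s => a v < s ∧ s < b v) := by
    ext s
    simp only [Finset.mem_filter, Finset.mem_Ioo, Finset.mem_insert, Finset.mem_singleton]
    constructor
    · rintro ⟨hs, hx⟩
      exact ⟨(h3 s (by omega)).1 hx, hs⟩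
    · rintro ⟨hx, hs⟩
      exact ⟨hs, (h3 s (by omega)).2 hx⟩
  rw [this, Finset.card_filter, Finset.sum_pair (by omega)]

/-- The two occurrences of a letter enclose, on one side, exactly its three neighbours. -/
theorem gap (h : IsPrismTwoWord n f a b) (hn : 3 ≤ n) (v) :
    (b v = a v + 4 ∧ ∀ s, a v < s → s < b v → (prism n).Adj v (f s)) ∨
      b v = a v + (4 * n - 4) := by
  classical
  set c : Fin n ⊕ Fin n → ℕ := fun x => ((Finset.Ioo (a v) (b v)).filter (f · = x)).card with hc
  obtain ⟨hv1, hv2, hv3⟩ := h.occurs v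
  have hcv : c v = 0 := by
    simp only [hc, h.card_between]
    split_ifs <;> omega
  have hadj : ∀ x, (prism n).Adj v x → c x = 1 := by
    intro x hx
    have hne := h.positions_ne hx.ne
    rw [h.adj_iff v x hx.ne] at hx
    have := (h.occurs x).1
    simp only [hc, h.card_between]
    split_ifs <;> omega
  have hnon : ∀ x, x ≠ v → ¬ (prism n).Adj v x →
      (a v < a x ∧ b x < b v ∧ c x = 2) ∨ (c x = 0 ∧
        ((b x < a v ∨ b v < a x) ∨ (a x < a v ∧ b v < b x))) := by
    intro x hxv hx
    have hne := h.positions_ne hxv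
    rw [h.adj_iff v x hxv.symm] at hx
    have := (h.occurs x).1
    simp only [hc, h.card_between]
    split_ifs <;> omega
  obtain ⟨c₀, hc₀⟩ := prism_constant_off_neighbors hn v c fun x y hxv hyv hx hy hxy => by
    have h1 := hnon x hxv hx
    have h2 := hnon y hyv hy
    rw [h.adj_iff x y hxy.ne] at hxy
    omega
  have hsum : b v - a v - 1 = ∑ x, c x := by
    rw [← Nat.card_Ioo]
    exact Finset.card_eq_sum_card_fiberwise (by simp [Set.MapsTo])
  let A := Finset.univ.filter ((prism n).Adj v)
  let B := Finset.univ.filter (fun x => x ≠ v ∧ ¬ (prism n).Adj v x)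
  have hsplit : ∀ g : Fin n ⊕ Fin n → ℕ, ∑ x, g x = ∑ x ∈ A, g x + (g v + ∑ x ∈ B, g x) := by
    intro g
    rw [← Finset.sum_filter_add_sum_filter_not Finset.univ ((prism n).Adj v)]
    congr 1
    rw [← Finset.sum_insert (by simp [B])]
    refine Finset.sum_congr ?_ fun _ _ => rfl
    ext x
    by_cases hx : x = v <;> simp [B, hx]
  have hA : A.card = 3 := prism_card_neighbors hn v
  have hB : 2 * n = 3 + (1 + B.card) := by
    have := hsplit fun _ => 1
    simp only [Finset.sum_const, hA] at this
    simp at this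
    omega
  have hsumB : ∑ x ∈ B, c x = B.card * c₀ := by
    rw [Finset.sum_congr rfl fun x hx => hc₀ x (Finset.mem_filter.1 hx).2.1
      (Finset.mem_filter.1 hx).2.2]
    simp
  have hsumA : ∑ x ∈ A, c x = 3 := by
    rw [Finset.sum_congr rfl fun x hx => hadj x (Finset.mem_filter.1 hx).2]
    rw [Finset.sum_const, hA, smul_eq_mul]
  rw [hsplit, hsumA, hsumB, hcv] at hsum
  obtain ⟨y, hy⟩ : B.Nonempty := Finset.card_pos.1 (by omega)
  have hy' := (Finset.mem_filter.1 hy).2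
  have hcy := hc₀ y hy'.1 hy'.2
  have hc02 : c₀ = 0 ∨ c₀ = 2 := by
    have := hnon y hy'.1 hy'.2
    omega
  rcases hc02 with h0 | h2
  · refine .inl ⟨by rw [h0] at hsum; omega, fun s hs1 hs2 => ?_⟩
    by_contra hna
    have hpos : 0 < c (f s) := Finset.card_pos.2 ⟨s, by simp [hs1, hs2]⟩
    have hsv : f s ≠ v := fun e => by rw [e] at hpos; omega
    rw [hc₀ _ hsv hna] at hpos
    omega
  · right
    rw [h2] at hsum
    omega

theorem exists_partner (h : IsPrismTwoWord n f a b) (hn : 3 ≤ n) {s : ℕ} (hs : s < 4 * n) :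
    ∃ t < 4 * n, f t = f s ∧
      (t = s + 4 ∨ s = t + 4 ∨ t = s + (4 * n - 4) ∨ s = t + (4 * n - 4)) := by
  obtain ⟨h1, h2, h3⟩ := h.occurs (f s)
  have hg := h.gap hn (f s)
  rcases (h3 s hs).1 rfl with hs' | hs'
  · exact ⟨b (f s), h2, h.letter_b _, by omega⟩
  · exact ⟨a (f s), by omega, h.letter_a _, by omega⟩

theorem eq_or_eq_or_eq (h : IsPrismTwoWord n f a b) {r s t : ℕ} (hr : r < 4 * n)
    (hs : s < 4 * n) (ht : t < 4 * n) (h1 : f r = f s) (h2 : f s = f t) :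
    r = s ∨ s = t ∨ r = t := by
  have h3 := (h.occurs (f t)).2.2
  have e1 := (h3 t ht).1 rfl
  have e2 := (h3 s hs).1 h2
  have e3 := (h3 r hr).1 (h1.trans h2)
  omega

theorem adj_of_between (h : IsPrismTwoWord n f a b) (hn : 3 ≤ n) {p s : ℕ}
    (hp : p + 4 < 4 * n) (hf : f (p + 4) = f p) (h1 : p < s) (h2 : s < p + 4) :
    (prism n).Adj (f p) (f s) := by
  have h3 := (h.occurs (f p)).2.2
  have h4 := (h.occurs (f p)).1
  have e1 := (h3 p (by omega)).1 rfl
  have e2 := (h3 _ hp).1 hf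
  rcases h.gap hn (f p) with hg | hg
  · exact hg.2 s (by omega) (by omega)
  · omega

end IsPrismTwoWord

theorem not_isPrismTwoWord_three {f : ℕ → Fin 3 ⊕ Fin 3} {a b : Fin 3 ⊕ Fin 3 → ℕ}
    (h : IsPrismTwoWord 3 f a b) : False := by
  obtain ⟨r, hr, hr1, hr2⟩ := h.exists_partner le_rfl (s := 0) (by omega)
  obtain ⟨s, hs, hs1, hs2⟩ := h.exists_partner le_rfl (s := 4) (by omega)
  obtain ⟨t, ht, ht1, ht2⟩ := h.exists_partner le_rfl (s := 8) (by omega)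
  have hall : f 0 = f 4 ∧ f 4 = f 8 := by
    replace hr2 : r = 4 ∨ r = 8 := by omega
    replace hs2 : s = 0 ∨ s = 8 := by omega
    replace ht2 : t = 0 ∨ t = 4 := by omega
    rcases hr2 with rfl | rfl <;> rcases hs2 with rfl | rfl <;> rcases ht2 with rfl | rfl <;>
      grind only
  have := h.eq_or_eq_or_eq (by omega) (by omega) (by omega) hall.1 hall.2
  omega

theorem not_isPrismTwoWord_of_four_le {n : ℕ} (hn : 4 ≤ n) {f : ℕ → Fin n ⊕ Fin n}
    {a b : Fin n ⊕ Fin n → ℕ} (h : IsPrismTwoWord n f a b) : False := by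
  have hn' : 3 ≤ n := by omega
  obtain ⟨p, hp4, hp8, hp⟩ : ∃ p, 4 ≤ p ∧ p ≤ 8 ∧ f (p + 4) = f p := by
    obtain ⟨t, ht, hft, hcase⟩ := h.exists_partner hn' (s := 8) (by omega)
    rcases hcase with rfl | hcase | hcase | hcase
    · exact ⟨8, by omega, le_rfl, hft⟩
    · obtain rfl : t = 4 := by omega
      exact ⟨4, le_rfl, by omega, hft.symm⟩
    · omega
    · omega
  have step : ∀ i, p < i → i < p + 4 → f (i + 4) = f i ∨ f (i - 4) = f i := by
    intro i h1 h2
    obtain ⟨t, ht, hft, hcase⟩ := h.exists_partner hn' (s := i) (by omega)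
    rcases hcase with rfl | hcase | hcase | hcase
    · exact .inl hft
    · obtain rfl : t = i - 4 := by omega
      exact .inr hft
    · omega
    · omega
  have nbr : ∀ i, p < i → i < p + 4 → (prism n).Adj (f p) (f i) := fun i h1 h2 =>
    h.adj_of_between hn' (by omega) hp h1 h2
  have up : ∀ i j, p < i → i < j → j < p + 4 → f (i + 4) = f i → False := by
    intro i j h1 h2 h3 hi
    exact prism_triangleFree hn (nbr i h1 (by omega)) (nbr j (by omega) h3)
      (h.adj_of_between hn' (by omega) hi h2 (by omega))
  have down : ∀ i j, p < i → i < j → j < p + 4 → f (i - 4) = f i → f (j - 4) = f j → False := by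
    intro i j h1 h2 h3 hi hj
    have e : i - 4 + 4 = i := by omega
    have := h.adj_of_between hn' (p := i - 4) (s := j - 4) (by omega) (by rw [e, hi])
      (by omega) (by omega)
    rw [hi, hj] at this
    exact prism_triangleFree hn (nbr i h1 (by omega)) (nbr j (by omega) h3) this
  rcases step (p + 1) (by omega) (by omega) with h1 | h1
  · exact up (p + 1) (p + 2) (by omega) (by omega) (by omega) h1
  rcases step (p + 2) (by omega) (by omega) with h2 | h2
  · exact up (p + 2) (p + 3) (by omega) (by omega) (by omega) h2
  exact down (p + 1) (p + 2) (by omega) (by omega) (by omega) h1 h2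

theorem not_kRepresentable_two_prism {n : ℕ} (hn : 3 ≤ n) : ¬ KRepresentable (prism n) 2 := by
  intro h
  obtain ⟨f, a, b, h⟩ := exists_isPrismTwoWord hn h
  rcases hn.eq_or_lt with rfl | hn
  · exact not_isPrismTwoWord_three h
  · exact not_isPrismTwoWord_of_four_le hn h

/-- The letter at position `s` of a `3`-uniform word of length `6 * n`: the block with number `t`
consists of the unprimed letters `t, t - 1, t - 2` followed by the primed letters
`t - 3, t, t - 1`, with indices modulo `n`. -/
def prismLetter (n : ℕ) [NeZero n] (s : ℕ) : Fin n ⊕ Fin n :=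
  if s % 6 = 0 then .inl (Fin.ofNat n (s / 6 + n - 0))
  else if s % 6 = 1 then .inl (Fin.ofNat n (s / 6 + n - 1))
  else if s % 6 = 2 then .inl (Fin.ofNat n (s / 6 + n - 2))
  else if s % 6 = 3 then .inr (Fin.ofNat n (s / 6 + n - 3))
  else if s % 6 = 4 then .inr (Fin.ofNat n (s / 6 + n - 0))
  else .inr (Fin.ofNat n (s / 6 + n - 1))

theorem ofNat_sub_eq_iff {n : ℕ} [NeZero n] {t c : ℕ} (ht : t < n) (hc : c ≤ n) (i : Fin n) :
    Fin.ofNat n (t + n - c) = i ↔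
      ((i : ℕ) + c < n ∧ t = i + c) ∨ (n ≤ (i : ℕ) + c ∧ t + n = i + c) := by
  rw [Fin.ext_iff, Fin.val_ofNat]
  by_cases h : c ≤ t
  · rw [show t + n - c = t - c + n by omega, Nat.add_mod_right, Nat.mod_eq_of_lt (by omega)]
    omega
  · rw [Nat.mod_eq_of_lt (by omega)]
    omega

theorem prismLetter_eq_inl_iff {n : ℕ} [NeZero n] (hn : 5 ≤ n) {s : ℕ} (hs : s < 6 * n)
    (i : Fin n) : prismLetter n s = .inl i ↔
      s = 6 * i ∨ (s = 6 * i + 7 ∨ s + 6 * n = 6 * i + 7) ∨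
        (s = 6 * i + 14 ∨ s + 6 * n = 6 * i + 14) := by
  have hi := i.2
  unfold prismLetter
  split_ifs <;>
    (try simp only [Sum.inl.injEq, false_iff,
      ofNat_sub_eq_iff (show s / 6 < n by omega) (show 0 ≤ n by omega),
      ofNat_sub_eq_iff (show s / 6 < n by omega) (show 1 ≤ n by omega),
      ofNat_sub_eq_iff (show s / 6 < n by omega) (show 2 ≤ n by omega)]) <;>
    omega

theorem prismLetter_eq_inr_iff {n : ℕ} [NeZero n] (hn : 5 ≤ n) {s : ℕ} (hs : s < 6 * n)
    (i : Fin n) : prismLetter n s = .inr i ↔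
      s = 6 * i + 4 ∨ (s = 6 * i + 11 ∨ s + 6 * n = 6 * i + 11) ∨
        (s = 6 * i + 21 ∨ s + 6 * n = 6 * i + 21) := by
  have hi := i.2
  unfold prismLetter
  split_ifs <;>
    (try simp only [Sum.inr.injEq, false_iff,
      ofNat_sub_eq_iff (show s / 6 < n by omega) (show 0 ≤ n by omega),
      ofNat_sub_eq_iff (show s / 6 < n by omega) (show 1 ≤ n by omega),
      ofNat_sub_eq_iff (show s / 6 < n by omega) (show 3 ≤ n by omega)]) <;>
    omega

theorem exists_occursAtThree_inl {n : ℕ} [NeZero n] (hn : 5 ≤ n) (i : Fin n) :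
    ∃ p q r, OccursAtThree (prismLetter n) (6 * n) (.inl i) p q r ∧
      (((i : ℕ) + 2 < n ∧ p = 6 * i ∧ q = 6 * i + 7 ∧ r = 6 * i + 14) ∨
        ((i : ℕ) + 2 = n ∧ p = 2 ∧ q = 6 * i ∧ r = 6 * i + 7) ∨
        ((i : ℕ) + 1 = n ∧ p = 1 ∧ q = 8 ∧ r = 6 * i)) := by
  obtain h | h | h : (i : ℕ) + 2 < n ∨ (i : ℕ) + 2 = n ∨ (i : ℕ) + 1 = n := by omega
  · refine ⟨_, _, _, ⟨?_, ?_, ?_, fun s hs => ?_⟩, .inl ⟨h, rfl, rfl, rfl⟩⟩ <;>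
      try rw [prismLetter_eq_inl_iff hn hs]
    all_goals omega
  · refine ⟨_, _, _, ⟨?_, ?_, ?_, fun s hs => ?_⟩, .inr (.inl ⟨h, rfl, rfl, rfl⟩)⟩ <;>
      try rw [prismLetter_eq_inl_iff hn hs]
    all_goals omega
  · refine ⟨_, _, _, ⟨?_, ?_, ?_, fun s hs => ?_⟩, .inr (.inr ⟨h, rfl, rfl, rfl⟩)⟩ <;>
      try rw [prismLetter_eq_inl_iff hn hs]
    all_goals omega

theorem exists_occursAtThree_inr {n : ℕ} [NeZero n] (hn : 5 ≤ n) (i : Fin n) :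
    ∃ p q r, OccursAtThree (prismLetter n) (6 * n) (.inr i) p q r ∧
      (((i : ℕ) + 3 < n ∧ p = 6 * i + 4 ∧ q = 6 * i + 11 ∧ r = 6 * i + 21) ∨
        ((i : ℕ) + 3 = n ∧ p = 3 ∧ q = 6 * i + 4 ∧ r = 6 * i + 11) ∨
        ((i : ℕ) + 2 = n ∧ p = 9 ∧ q = 6 * i + 4 ∧ r = 6 * i + 11) ∨
        ((i : ℕ) + 1 = n ∧ p = 5 ∧ q = 15 ∧ r = 6 * i + 4)) := by
  obtain h | h | h | h : (i : ℕ) + 3 < n ∨ (i : ℕ) + 3 = n ∨ (i : ℕ) + 2 = n ∨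
      (i : ℕ) + 1 = n := by omega
  · refine ⟨_, _, _, ⟨?_, ?_, ?_, fun s hs => ?_⟩, .inl ⟨h, rfl, rfl, rfl⟩⟩ <;>
      try rw [prismLetter_eq_inr_iff hn hs]
    all_goals omega
  · refine ⟨_, _, _, ⟨?_, ?_, ?_, fun s hs => ?_⟩, .inr (.inl ⟨h, rfl, rfl, rfl⟩)⟩ <;>
      try rw [prismLetter_eq_inr_iff hn hs]
    all_goals omega
  · refine ⟨_, _, _, ⟨?_, ?_, ?_, fun s hs => ?_⟩, .inr (.inr (.inl ⟨h, rfl, rfl, rfl⟩))⟩ <;>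
      try rw [prismLetter_eq_inr_iff hn hs]
    all_goals omega
  · refine ⟨_, _, _, ⟨?_, ?_, ?_, fun s hs => ?_⟩, .inr (.inr (.inr ⟨h, rfl, rfl, rfl⟩))⟩ <;>
      try rw [prismLetter_eq_inr_iff hn hs]
    all_goals omega

theorem Alternate.symm {V : Type*} [DecidableEq V] {w : List V} {x y : V}
    (h : Alternate w x y) : Alternate w y x := by
  unfold Alternate at *
  simpa only [or_comm] using h

theorem mem_of_kUniform {V : Type*} [DecidableEq V] {w : List V} {k : ℕ} (hk : k ≠ 0)
    (hw : KUniform k w) (v : V) : v ∈ w :=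
  List.count_pos_iff.1 (by rw [hw v]; omega)

theorem kRepresentable_three_prism_of_five_le {n : ℕ} (hn : 5 ≤ n) :
    KRepresentable (prism n) 3 := by
  have hn' : 3 ≤ n := by omega
  have : NeZero n := ⟨by omega⟩
  have hw : KUniform 3 ((List.range (6 * n)).map (prismLetter n)) := by
    rintro (i | i)
    · obtain ⟨p, q, r, h, -⟩ := exists_occursAtThree_inl hn i
      exact h.count_eq
    · obtain ⟨p, q, r, h, -⟩ := exists_occursAtThree_inr hn i
      exact h.count_eq
  have hlr : ∀ i j : Fin n,
      Alternate ((List.range (6 * n)).map (prismLetter n)) (.inl i) (.inr j) ↔ i = j := by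
    intro i j
    obtain ⟨p, q, r, h, hp⟩ := exists_occursAtThree_inl hn i
    obtain ⟨p', q', r', h', hp'⟩ := exists_occursAtThree_inr hn j
    rw [alternate_iff_of_occursAtThree (by simp) h h', Fin.ext_iff]
    rcases hp with hp | hp | hp <;> rcases hp' with hp' | hp' | hp' | hp' <;> omega
  refine ⟨_, hw, mem_of_kUniform (by omega) hw, ?_⟩
  rintro (i | i) (j | j) hij
  · obtain ⟨p, q, r, h, hp⟩ := exists_occursAtThree_inl hn i
    obtain ⟨p', q', r', h', hp'⟩ := exists_occursAtThree_inl hn j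
    rw [alternate_iff_of_occursAtThree hij h h', prism_adj_inl_inl hn', CycleAdj]
    rw [ne_eq, Sum.inl.injEq, Fin.ext_iff] at hij
    rcases hp with hp | hp | hp <;> rcases hp' with hp' | hp' | hp' <;> omega
  · rw [hlr, prism_adj_inl_inr]
  · rw [prism_adj_inr_inl, eq_comm, ← hlr]
    exact ⟨Alternate.symm, Alternate.symm⟩
  · obtain ⟨p, q, r, h, hp⟩ := exists_occursAtThree_inr hn i
    obtain ⟨p', q', r', h', hp'⟩ := exists_occursAtThree_inr hn j
    rw [alternate_iff_of_occursAtThree hij h h', prism_adj_inr_inr hn', CycleAdj]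
    rw [ne_eq, Sum.inr.injEq, Fin.ext_iff] at hij
    rcases hp with hp | hp | hp | hp <;> rcases hp' with hp' | hp' | hp' | hp' <;> omega

instance decidableAlternate {V : Type*} [DecidableEq V] (w : List V) (x y : V) :
    Decidable (Alternate w x y) :=
  inferInstanceAs (Decidable (List.IsChain (· ≠ ·) _))

instance decidableCycleAdj {n : ℕ} (i j : Fin n) : Decidable (CycleAdj i j) := by
  unfold CycleAdj
  infer_instance

theorem kRepresentable_prism_of_alternate_iff {n k : ℕ} (hn : 3 ≤ n) (hk : k ≠ 0)
    {w : List (Fin n ⊕ Fin n)} (hw : KUniform k w)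
    (hll : ∀ i j, i ≠ j → (Alternate w (.inl i) (.inl j) ↔ CycleAdj i j))
    (hrr : ∀ i j, i ≠ j → (Alternate w (.inr i) (.inr j) ↔ CycleAdj i j))
    (hlr : ∀ i j, Alternate w (.inl i) (.inr j) ↔ i = j) : KRepresentable (prism n) k := by
  refine ⟨w, hw, mem_of_kUniform hk hw, ?_⟩
  rintro (i | i) (j | j) hij
  · rw [prism_adj_inl_inl hn]
    exact hll i j (by simpa using hij)
  · rw [hlr, prism_adj_inl_inr]
  · rw [prism_adj_inr_inl, eq_comm, ← hlr]
    exact ⟨Alternate.symm, Alternate.symm⟩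
  · rw [prism_adj_inr_inr hn]
    exact hrr i j (by simpa using hij)

theorem kRepresentable_three_prism_three : KRepresentable (prism 3) 3 :=
  kRepresentable_prism_of_alternate_iff (w := [.inr 1, .inr 2, .inr 0, .inl 1, .inr 1, .inl 2,
    .inl 0, .inl 1, .inr 2, .inl 2, .inr 0, .inr 1, .inr 2, .inl 0, .inl 1, .inr 0, .inl 2,
    .inl 0]) (by omega) (by omega) (by unfold KUniform; decide) (by decide) (by decide) (by decide)

theorem kRepresentable_three_prism_four : KRepresentable (prism 4) 3 :=
  kRepresentable_prism_of_alternate_iff (w := [.inl 0, .inl 2, .inl 3, .inr 1, .inr 0, .inl 1,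
    .inl 0, .inr 2, .inr 3, .inr 1, .inl 2, .inr 2, .inl 1, .inl 3, .inl 2, .inr 0, .inr 1,
    .inr 3, .inl 0, .inr 0, .inl 3, .inr 2, .inr 3, .inl 1])
    (by omega) (by omega) (by unfold KUniform; decide) (by decide) (by decide) (by decide)

theorem kRepresentable_three_prism {n : ℕ} (hn : 3 ≤ n) : KRepresentable (prism n) 3 := by
  obtain rfl | rfl | hn : n = 3 ∨ n = 4 ∨ 5 ≤ n := by omega
  · exact kRepresentable_three_prism_three
  · exact kRepresentable_three_prism_four
  · exact kRepresentable_three_prism_of_five_le hn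

theorem not_kRepresentable_one_prism {n : ℕ} (hn : 3 ≤ n) : ¬ KRepresentable (prism n) 1 := by
  intro h
  have hadj : (prism n).Adj (.inl ⟨0, by omega⟩) (.inr ⟨1, by omega⟩) := by
    rw [eq_top_of_kRepresentable_one h]
    simp
  simp [prism_adj_inl_inr] at hadj

/-- For every `n ≥ 3`, the prism `Pr n` is 3-word-representable but not
2-word-representable; consequently its representation number equals 3. -/
theorem prism_representation_number_eq_three (n : ℕ) (hn : 3 ≤ n) :
    KRepresentable (prism n) 3 ∧ ¬ KRepresentable (prism n) 2 ∧ reprNum (prism n) = 3 := by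
  have h3 := kRepresentable_three_prism hn
  have h2 := not_kRepresentable_two_prism hn
  refine ⟨h3, h2, le_antisymm (Nat.sInf_le h3) ?_⟩
  refine le_csInf ⟨3, h3⟩ fun k (hk : KRepresentable (prism n) k) => ?_
  by_contra hlt
  have : Nonempty (Fin n ⊕ Fin n) := ⟨.inl ⟨0, by omega⟩⟩
  obtain rfl | rfl | rfl : k = 0 ∨ k = 1 ∨ k = 2 := by omega
  · exact not_kRepresentable_zero _ hk
  · exact not_kRepresentable_one_prism hn hk
  · exact h2 hk
end

section
/- Let G1 = (V1,E1) and G2 = (V2,E2) be vertex-disjoint word-representable graphs with |V1| ≥ 2 and |V2| ≥ 2, with representation numbers R(G1) = k1 and R(G2) = k2, and let x ∈ V1 and y ∈ V2. Let G'' be the graph obtained from G1 and G2 by identifying x and y into a single new vertex z: its vertex set is (V1 \ {x}) ∪ (V2 \ {y}) ∪ {z}, the vertex z is adjacent exactly to the G1-neighbors of x and the G2-neighbors of y, and all other adjacencies are inherited from G1 and G2. Then G'' is word-representable and R(G'') = max(k1, k2, 2). -/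
section Words

variable {V W : Type*} [DecidableEq V] [DecidableEq W]

theorem alternate_iff {w : List V} {a b : V} :
    Alternate w a b ↔ (w.filter (fun z => decide (z = a ∨ z = b))).IsChain (· ≠ ·) :=
  Iff.rfl

theorem alternate_comm {w : List V} {a b : V} : Alternate w a b ↔ Alternate w b a := by
  simp only [alternate_iff, or_comm]

theorem Alternate.of_infix {s w : List V} {a b : V} (h : Alternate w a b) (hs : s <:+: w) :
    Alternate s a b :=
  List.IsChain.infix h (hs.filter _)

theorem count_filter_pair_left (w : List V) (a b : V) :
    (w.filter (fun z => decide (z = a ∨ z = b))).count a = w.count a :=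
  List.count_filter (by simp)

theorem count_filter_pair_right (w : List V) (a b : V) :
    (w.filter (fun z => decide (z = a ∨ z = b))).count b = w.count b :=
  List.count_filter (by simp)

/-- An alternating word in two letters that starts with `a` either ends with `a`, and then
contains `a` once more than `b`, or ends with `b`, and then contains both equally often. -/
theorem isChain_pair_dichotomy (T : List V) : ∀ {a b : V}, a ≠ b → (∀ c ∈ T, c = a ∨ c = b) →
    (a :: T).IsChain (· ≠ ·) →
    ((a :: T ++ [a]).IsChain (· ≠ ·) ∧ T.count a + 1 = T.count b) ∨
    ((a :: T ++ [b]).IsChain (· ≠ ·) ∧ T.count a = T.count b) := by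
  induction T with
  | nil => intro a b hab _ _; right; simpa using hab
  | cons c T ih =>
    intro a b hab hT hc
    rw [List.isChain_cons_cons] at hc
    have hcb : c = b := (hT c (by simp)).resolve_left hc.1.symm
    subst hcb
    have hT' : ∀ d ∈ T, d = c ∨ d = a := fun d hd => (hT d (by simp [hd])).symm
    rcases ih hab.symm hT' hc.2 with ⟨h1, h2⟩ | ⟨h1, h2⟩
    · right
      refine ⟨?_, ?_⟩
      · simpa [List.isChain_cons_cons, hab] using h1
      · simp [hab.symm]; omega
    · left
      refine ⟨?_, ?_⟩
      · simpa [List.isChain_cons_cons, hab] using h1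
      · simp [hab.symm]; omega

theorem Alternate.rotate_one {c : V} {t : List V} {a b : V} (hab : a ≠ b)
    (hcount : (c :: t).count a = (c :: t).count b) (h : Alternate (c :: t) a b) :
    Alternate (t ++ [c]) a b := by
  by_cases hc : c = a ∨ c = b
  · wlog hca : c = a generalizing a b
    · exact alternate_comm.1 (this hab.symm hcount.symm (alternate_comm.1 h) hc.symm
        (hc.resolve_left hca))
    subst hca
    rw [alternate_iff] at h ⊢
    rw [List.filter_cons_of_pos (by simp)] at h
    rcases isChain_pair_dichotomy _ hab (fun d hd => by simpa using (List.mem_filter.1 hd).2) h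
      with ⟨h1, h2⟩ | ⟨h1, h2⟩
    · rw [List.filter_append]
      simpa using (List.isChain_cons.1 h1).2
    · rw [count_filter_pair_left, count_filter_pair_right] at h2
      simp [hab] at hcount
      omega
  · rw [alternate_iff] at h ⊢
    rw [List.filter_append]
    simpa [List.filter_cons, hc] using h

theorem Alternate.rotate {p : List V} {a b : V} (hab : a ≠ b) : ∀ {q : List V},
    (p ++ q).count a = (p ++ q).count b → Alternate (p ++ q) a b → Alternate (q ++ p) a b := by
  induction p with
  | nil => intro q _ h; simpa using h
  | cons c p ih =>
    intro q hcount h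
    have h1 := Alternate.rotate_one (c := c) (t := p ++ q) hab hcount h
    rw [List.append_assoc] at h1
    have h2 := ih (q := q ++ [c]) (by simp [List.count_cons] at hcount ⊢; omega) h1
    simpa using h2

theorem represents_rotate {G : SimpleGraph V} {k : ℕ} {p q : List V}
    (hk : KUniform k (p ++ q)) (h : Represents (p ++ q) G) : Represents (q ++ p) G := by
  have hk' : KUniform k (q ++ p) := fun v => by
    rw [← hk v, List.count_append, List.count_append, add_comm]
  refine ⟨fun v => by simpa [or_comm] using h.1 v, fun a b hab => ?_⟩
  rw [← h.2 a b hab]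
  exact ⟨Alternate.rotate hab (by rw [hk' a, hk' b]), Alternate.rotate hab (by rw [hk a, hk b])⟩

theorem eraseDups_filter (p : V → Bool) (l : List V) :
    l.eraseDups.filter p = (l.filter p).eraseDups := by
  induction hn : l.length using Nat.strong_induction_on generalizing l with
  | _ n ih =>
    cases l with
    | nil => simp
    | cons c t =>
      have hlen : (t.filter (fun b => !b == c)).length < n := by
        have := List.length_filter_le (fun b => !b == c) t
        simp at hn; omega
      rw [List.eraseDups_cons, List.filter_cons, ih _ hlen _ rfl, List.filter_filter,
        List.filter_cons]
      by_cases hp : p c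
      · simp only [hp, if_true, List.eraseDups_cons, List.filter_filter, Bool.and_comm]
      · simp only [hp, Bool.false_eq_true, if_false]
        congr 1
        apply List.filter_congr
        intro d _
        by_cases hd : d = c
        · subst hd; simp [hp]
        · simp [hd]

theorem count_eraseDups (l : List V) (a : V) (ha : a ∈ l) : l.eraseDups.count a = 1 := by
  have h1 : l.eraseDups.count a = (l.eraseDups.filter (· == a)).count a :=
    (List.count_filter (by simp)).symm
  obtain ⟨n, hn⟩ := Nat.exists_eq_succ_of_ne_zero (List.count_pos_iff.2 ha).ne'
  rw [h1, eraseDups_filter, List.filter_beq, hn, List.replicate_succ, List.eraseDups_cons,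
    List.filter_eq_nil_iff.2]
  · simp
  · intro b hb; simp [List.eq_of_mem_replicate hb]

theorem eraseDups_pair {a b : V} {T : List V} (hab : a ≠ b) (hT : ∀ c ∈ T, c = a ∨ c = b)
    (hb : b ∈ T) : (a :: T).eraseDups = [a, b] := by
  have h : T.filter (fun c => !c == a) = T.filter (· == b) := by
    apply List.filter_congr
    intro c hc
    rcases hT c hc with rfl | rfl
    · simp [hab]
    · simp [hab.symm]
  obtain ⟨n, hn⟩ := Nat.exists_eq_succ_of_ne_zero (List.count_pos_iff.2 hb).ne'
  rw [List.eraseDups_cons, h, List.filter_beq, hn, List.replicate_succ, List.eraseDups_cons,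
    List.filter_eq_nil_iff.2]
  · simp
  · intro c hc; simp [List.eq_of_mem_replicate hc]

/-- The letters occurring fewer than `m` times in `w`, in order of first occurrence. -/
def rareLetters (m : ℕ) (w : List V) : List V :=
  w.eraseDups.filter (fun v => decide (w.count v < m))

theorem count_rareLetters_append (m : ℕ) {w : List V} {v : V} (hv : v ∈ w) :
    (rareLetters m w ++ w).count v = if w.count v < m then w.count v + 1 else w.count v := by
  rw [List.count_append, rareLetters]
  split_ifs with h
  · rw [List.count_filter (by simpa using h), count_eraseDups _ _ hv, add_comm]
  · rw [List.count_eq_zero_of_not_mem (by simp [h]), zero_add]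

theorem Alternate.rareLetters_append {m : ℕ} {w : List V} {a b : V} (hab : a ≠ b)
    (ha : a ∈ w) (hb : b ∈ w) (hma : w.count a ≤ m) (hmb : w.count b ≤ m)
    (h : Alternate w a b) : Alternate (rareLetters m w ++ w) a b := by
  have hmem : a ∈ w.filter (fun z => decide (z = a ∨ z = b)) := by simp [ha]
  obtain ⟨c, T, hl⟩ := List.exists_cons_of_ne_nil (List.ne_nil_of_mem hmem)
  have hlet : ∀ d ∈ c :: T, d = a ∨ d = b := fun d hd => by
    rw [← hl] at hd; simpa using (List.mem_filter.1 hd).2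
  wlog hca : c = a generalizing a b
  · have hl' := hl
    simp only [or_comm (a := _ = a)] at hl'
    exact alternate_comm.1 (this hab.symm hb ha hmb hma (alternate_comm.1 h)
      (by simp [hb]) hl' (fun d hd => (hlet d hd).symm)
      ((hlet c (by simp)).resolve_left hca))
  subst hca
  have hT : ∀ d ∈ T, d = c ∨ d = b := fun d hd => hlet d (by simp [hd])
  have hbT : b ∈ T := by
    have : b ∈ w.filter (fun z => decide (z = c ∨ z = b)) := by simp [hb]
    rw [hl] at this
    simpa [hab.symm] using this
  have hca : w.count c = T.count c + 1 := by
    rw [← count_filter_pair_left w c b, hl]; simp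
  have hcb : w.count b = T.count b := by
    rw [← count_filter_pair_right w c b, hl]; simp [hab]
  rw [alternate_iff, hl] at h
  have hle : w.count b ≤ w.count c := by
    rcases isChain_pair_dichotomy T hab hT h with h' | h' <;> omega
  rw [alternate_iff, List.filter_append, hl, rareLetters, List.filter_filter,
    ← List.filter_congr (fun v _ => Bool.and_comm _ _), ← List.filter_filter,
    eraseDups_filter, hl, eraseDups_pair hab hT hbT]
  by_cases h1 : w.count c < m
  · have h2 : w.count b < m := by omega
    simpa [h1, h2, List.isChain_cons_cons, hab, hab.symm] using h
  · by_cases h2 : w.count b < m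
    · simpa [List.filter_cons, h1, h2, List.isChain_cons_cons, hab.symm] using h
    · simpa [List.filter_cons, h1, h2] using h

theorem represents_rareLetters_append {G : SimpleGraph V} {m : ℕ} {w : List V}
    (hm : ∀ v, w.count v ≤ m) (h : Represents w G) :
    Represents (rareLetters m w ++ w) G := by
  refine ⟨fun v => by simp [h.1 v], fun a b hab => ?_⟩
  rw [← h.2 a b hab]
  exact ⟨fun h' => h'.of_infix (List.suffix_append _ _).isInfix,
    Alternate.rareLetters_append hab (h.1 a) (h.1 b) (hm a) (hm b)⟩

theorem kRepresentable_of_count_le {G : SimpleGraph V} {m : ℕ} {w : List V}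
    (hm : ∀ v, w.count v ≤ m) (h : Represents w G) : KRepresentable G m := by
  have key : ∀ n : ℕ, ∃ u : List V, Represents u G ∧ ∀ v, u.count v ≤ m ∧ min n m ≤ u.count v := by
    intro n
    induction n with
    | zero => exact ⟨w, h, fun v => ⟨hm v, by simp⟩⟩
    | succ n ih =>
      obtain ⟨u, hu, hc⟩ := ih
      refine ⟨_, represents_rareLetters_append (fun v => (hc v).1) hu, fun v => ?_⟩
      have := hc v
      rw [count_rareLetters_append m (hu.1 v)]
      split_ifs <;> omega
  obtain ⟨u, hu, hc⟩ := key m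
  exact ⟨u, fun v => by have := hc v; omega, hu⟩

theorem KRepresentable.mono {G : SimpleGraph V} {k m : ℕ} (h : KRepresentable G k)
    (hkm : k ≤ m) : KRepresentable G m := by
  obtain ⟨w, hk, hw⟩ := h
  exact kRepresentable_of_count_le (fun v => (hk v).trans_le hkm) hw

theorem kRepresentable_reprNum {G : SimpleGraph V} (h : WordRepresentable G) :
    KRepresentable G (reprNum G) := by
  obtain ⟨w, hw⟩ := h
  exact Nat.sInf_mem (s := {k | KRepresentable G k})
    ⟨w.length, kRepresentable_of_count_le (fun v => List.count_le_length) hw⟩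

/-- The number of occurrences of the letter `v` in `w`. -/
def occurrences (v : V) (w : List V) : ℕ := w.count v

theorem occurrences_nil (v : V) : occurrences v [] = 0 := rfl

theorem occurrences_cons (v c : V) (w : List V) :
    occurrences v (c :: w) = occurrences v w + if c = v then 1 else 0 := by
  simp [occurrences, List.count_cons]

theorem occurrences_append (v : V) (w w' : List V) :
    occurrences v (w ++ w') = occurrences v w + occurrences v w' :=
  List.count_append

theorem occurrences_eq_zero_of_not_mem {v : V} {w : List V} (h : v ∉ w) : occurrences v w = 0 :=
  List.count_eq_zero_of_not_mem h

theorem mem_of_occurrences_pos {v : V} {w : List V} (h : 0 < occurrences v w) : v ∈ w :=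
  List.count_pos_iff.1 h

theorem kUniform_iff_occurrences {k : ℕ} {w : List V} :
    KUniform k w ↔ ∀ v, occurrences v w = k :=
  Iff.rfl

theorem occurrences_filterMap {f : V → W} {g : W → Option V}
    (hg : ∀ v w, g w = some v ↔ w = f v) (w : List W) (a : V) :
    occurrences a (w.filterMap g) = occurrences (f a) w := by
  rw [occurrences, occurrences]
  rw [List.count_filterMap, List.count]
  apply List.countP_congr
  intro c _
  simp [hg]

theorem alternate_filterMap {f : V → W} {g : W → Option V}
    (hg : ∀ v w, g w = some v ↔ w = f v) (w : List W) (a b : V) :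
    Alternate (w.filterMap g) a b ↔ Alternate w (f a) (f b) := by
  have hf : Function.Injective f := fun v v' hv => by
    have h1 := (hg v (f v)).2 rfl
    have h2 := (hg v' (f v)).2 hv
    exact Option.some.inj (h1.symm.trans h2)
  have hmap : ((w.filterMap g).filter (fun z => decide (z = a ∨ z = b))).map f
      = w.filter (fun z => decide (z = f a ∨ z = f b)) := by
    induction w with
    | nil => simp
    | cons c w ih =>
      cases hc : g c with
      | none =>
        have h1 : c ≠ f a := fun h => by simp [(hg a c).2 h] at hc
        have h2 : c ≠ f b := fun h => by simp [(hg b c).2 h] at hc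
        simpa [hc, List.filter_cons, h1, h2] using ih
      | some v =>
        obtain rfl := (hg v c).1 hc
        simp only [List.filterMap_cons, hc, List.filter_cons, hf.eq_iff]
        split_ifs
        · rw [List.map_cons, ih]
        · exact ih
  rw [alternate_iff, alternate_iff, ← hmap, List.isChain_map]
  simp only [hf.ne_iff]

theorem KRepresentable.of_embedding {H : SimpleGraph V} {G : SimpleGraph W} {k : ℕ}
    (h : KRepresentable G k) (f : H ↪g G) : KRepresentable H k := by
  classical
  obtain ⟨w, hk, hw⟩ := h
  have hg : ∀ (v : V) (c : W), Function.partialInv f c = some v ↔ c = f v := fun v c =>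
    (f.injective.isPartialInv v c).trans eq_comm
  refine ⟨w.filterMap (Function.partialInv f), fun v => ?_, fun v => ?_, fun a b hab => ?_⟩
  · exact (occurrences_filterMap hg w v).trans (hk _)
  · exact List.mem_filterMap.2 ⟨f v, hw.1 _, (hg _ _).2 rfl⟩
  · rw [alternate_filterMap hg, hw.2 _ _ (f.injective.ne hab), f.map_adj_iff]

theorem two_le_of_kRepresentable {G : SimpleGraph V} {k : ℕ} (h : KRepresentable G k)
    {a b : V} (hab : a ≠ b) (hG : ¬ G.Adj a b) : 2 ≤ k := by
  obtain ⟨w, hk, hw⟩ := h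
  by_contra hlt
  refine hG ((hw.2 a b hab).1 ?_)
  have hnd : w.Nodup := List.nodup_iff_count_le_one.2 fun v => by rw [hk v]; omega
  exact List.Pairwise.isChain (hnd.filter _)

theorem Alternate.occurrences_le_one {s w : List V} {a b : V} (h : Alternate w a b)
    (hs : s <:+: w) (hb : b ∉ s) : occurrences a s ≤ 1 := by
  have h' := h.of_infix hs
  have hfil : s.filter (fun z => decide (z = a ∨ z = b)) = s.filter (· == a) := by
    apply List.filter_congr
    intro c hc
    have : c ≠ b := fun hcb => hb (hcb ▸ hc)
    simp [this, beq_eq_decide]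
  rw [alternate_iff, hfil, List.filter_beq] at h'
  rw [occurrences]
  by_contra hlt
  obtain ⟨n, hn⟩ : ∃ n, s.count a = n + 2 := ⟨s.count a - 2, by omega⟩
  simp [hn, List.replicate_succ] at h'

end Words

section Glue

variable {α β : Type*}

theorem exists_optionBlocks (u : List (Option α)) [DecidableEq α] :
    ∃ As : List (List α), As.length = occurrences none u + 1 ∧
      u ++ [none] = As.flatMap (fun A => A.map some ++ [none]) := by
  induction u with
  | nil => exact ⟨[[]], by simp [occurrences_nil]⟩
  | cons c u ih =>
    obtain ⟨As, hlen, hAs⟩ := ih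
    cases c with
    | none => exact ⟨[] :: As, by simp [hlen, occurrences_cons], by simp [hAs]⟩
    | some a =>
      cases As with
      | nil => simp at hlen
      | cons A As => exact ⟨(a :: A) :: As, by simpa [occurrences_cons] using hlen, by simpa using hAs⟩

/-- A `k`-representable graph has a `k`-uniform representing word that ends in `none`. -/
theorem KRepresentable.exists_blocks [DecidableEq α] {H : SimpleGraph (Option α)} {k : ℕ}
    (h : KRepresentable H k) : ∃ As : List (List α), As.length = k ∧
      KUniform k (As.flatMap (fun A => A.map some ++ [none])) ∧
      Represents (As.flatMap (fun A => A.map some ++ [none])) H := by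
  obtain ⟨w, hk, hw⟩ := h
  obtain ⟨p, q, rfl⟩ := List.append_of_mem (hw.1 none)
  obtain ⟨As, hlen, hAs⟩ := exists_optionBlocks (q ++ p)
  have heq : As.flatMap (fun A => A.map some ++ [none]) = q ++ (p ++ [none]) := by
    rw [← hAs, List.append_assoc]
  have hsplit : p ++ none :: q = (p ++ [none]) ++ q := by simp
  rw [hsplit] at hk hw
  refine ⟨As, ?_, ?_, ?_⟩
  · rw [hlen, ← kUniform_iff_occurrences.1 hk none]
    simp only [occurrences_append, occurrences_cons, occurrences_nil, if_true]
    omega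
  · rw [heq, kUniform_iff_occurrences]
    intro v
    rw [← kUniform_iff_occurrences.1 hk v, occurrences_append, occurrences_append v _ q, add_comm]
  · rw [heq]; exact represents_rotate hk hw

/-- The letters of a left and a right block, followed by the common letter. -/
def glueBlock (p : List α × List β) : List (Option (α ⊕ β)) :=
  p.1.map (some ∘ Sum.inl) ++ p.2.map (some ∘ Sum.inr) ++ [none]

/-- The word of the glued graph, with the first two right blocks displaced. -/
def glueWord (A₁ A₂ : List α) (B₁ B₂ : List β) (L : List (List α × List β)) :
    List (Option (α ⊕ β)) :=
  B₁.map (some ∘ Sum.inr) ++ ((A₁.map (some ∘ Sum.inl) ++ none :: A₂.map (some ∘ Sum.inl)) ++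
    (B₂.map (some ∘ Sum.inr) ++ none :: L.flatMap glueBlock))

/-- Erasing the right letters. -/
def leftPart : Option (α ⊕ β) → Option (Option α)
  | none => some none
  | some (Sum.inl a) => some (some a)
  | some (Sum.inr _) => none

/-- Erasing the left letters. -/
def rightPart : Option (α ⊕ β) → Option (Option β)
  | none => some none
  | some (Sum.inl _) => none
  | some (Sum.inr b) => some (some b)

theorem leftPart_eq_some (v : Option α) (c : Option (α ⊕ β)) :
    leftPart c = some v ↔ c = v.map Sum.inl := by
  rcases c with _ | a | b <;> cases v <;> simp [leftPart]

theorem rightPart_eq_some (v : Option β) (c : Option (α ⊕ β)) :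
    rightPart c = some v ↔ c = v.map Sum.inr := by
  rcases c with _ | a | b <;> cases v <;> simp [rightPart]

theorem filterMap_leftPart_inl (A : List α) :
    (A.map (some ∘ Sum.inl : α → Option (α ⊕ β))).filterMap leftPart = A.map some := by
  induction A with
  | nil => rfl
  | cons a A ih => simpa [leftPart] using ih

theorem filterMap_leftPart_inr (B : List β) :
    (B.map (some ∘ Sum.inr : β → Option (α ⊕ β))).filterMap leftPart = [] := by
  induction B with
  | nil => rfl
  | cons a A ih => simp [leftPart]

theorem filterMap_rightPart_inl (A : List α) :
    (A.map (some ∘ Sum.inl : α → Option (α ⊕ β))).filterMap rightPart = [] := by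
  induction A with
  | nil => rfl
  | cons a A ih => simp [rightPart]

theorem filterMap_rightPart_inr (B : List β) :
    (B.map (some ∘ Sum.inr : β → Option (α ⊕ β))).filterMap rightPart = B.map some := by
  induction B with
  | nil => rfl
  | cons a A ih => simpa [rightPart] using ih

theorem filterMap_leftPart_glueWord (A₁ A₂ : List α) (B₁ B₂ : List β)
    (L : List (List α × List β)) :
    (glueWord A₁ A₂ B₁ B₂ L).filterMap leftPart =
      (A₁ :: A₂ :: L.map Prod.fst).flatMap (fun A => A.map some ++ [none]) := by
  have hL : (L.flatMap glueBlock).filterMap leftPart =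
      (L.map Prod.fst).flatMap (fun A => A.map some ++ [none]) := by
    induction L with
    | nil => rfl
    | cons p L ih =>
      rw [List.flatMap_cons, List.filterMap_append, ih, glueBlock]
      simp only [List.filterMap_append, filterMap_leftPart_inl, filterMap_leftPart_inr]
      simp [leftPart]
  simp only [glueWord, List.filterMap_append, List.filterMap_cons, filterMap_leftPart_inl,
    filterMap_leftPart_inr, hL]
  simp [leftPart]

theorem filterMap_rightPart_glueWord (A₁ A₂ : List α) (B₁ B₂ : List β)
    (L : List (List α × List β)) :
    (glueWord A₁ A₂ B₁ B₂ L).filterMap rightPart =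
      (B₁ :: B₂ :: L.map Prod.snd).flatMap (fun B => B.map some ++ [none]) := by
  have hL : (L.flatMap glueBlock).filterMap rightPart =
      (L.map Prod.snd).flatMap (fun B => B.map some ++ [none]) := by
    induction L with
    | nil => rfl
    | cons p L ih =>
      rw [List.flatMap_cons, List.filterMap_append, ih, glueBlock]
      simp only [List.filterMap_append, filterMap_rightPart_inl, filterMap_rightPart_inr]
      simp [rightPart]
  simp only [glueWord, List.filterMap_append, List.filterMap_cons, filterMap_rightPart_inl,
    filterMap_rightPart_inr, hL]
  simp [rightPart]

variable [DecidableEq α] [DecidableEq β]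

theorem occurrences_inl_flatMap_glueBlock_le (L : List (List α × List β)) {a : α} {b : β}
    (h : Alternate (L.flatMap glueBlock) (some (Sum.inl a)) (some (Sum.inr b))) :
    occurrences (some (Sum.inl a)) (L.flatMap glueBlock) ≤ L.length := by
  induction L with
  | nil => simp [occurrences_nil]
  | cons p L ih =>
    rw [List.flatMap_cons] at h ⊢
    have h1 := ih (h.of_infix (List.suffix_append _ _).isInfix)
    have h2 : occurrences (some (Sum.inl a)) (p.1.map (some ∘ Sum.inl : α → Option (α ⊕ β))) ≤ 1 :=
      h.occurrences_le_one ⟨[], p.2.map (some ∘ Sum.inr) ++ [none] ++ L.flatMap glueBlock,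
        by simp [glueBlock]⟩ (by simp)
    have h3 : occurrences (some (Sum.inl a)) (p.2.map (some ∘ Sum.inr) ++ [none]) = 0 :=
      occurrences_eq_zero_of_not_mem (by simp)
    rw [occurrences_append, glueBlock, List.append_assoc, occurrences_append, h3,
      List.length_cons]
    omega

theorem occurrences_inl_glueWord_le {A₁ A₂ : List α} {B₁ B₂ : List β} {L : List (List α × List β)}
    {a : α} {b : β}
    (h : Alternate (glueWord A₁ A₂ B₁ B₂ L) (some (Sum.inl a)) (some (Sum.inr b))) :
    occurrences (some (Sum.inl a)) (glueWord A₁ A₂ B₁ B₂ L) ≤ L.length + 1 := by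
  have hR (B : List β) :
      occurrences (some (Sum.inl a)) (B.map (some ∘ Sum.inr)) = 0 :=
    occurrences_eq_zero_of_not_mem (by simp)
  have h1 := occurrences_inl_flatMap_glueBlock_le L (a := a) (b := b)
    (h.of_infix ⟨B₁.map (some ∘ Sum.inr) ++ (A₁.map (some ∘ Sum.inl) ++
      none :: A₂.map (some ∘ Sum.inl)) ++ B₂.map (some ∘ Sum.inr) ++ [none], [],
      by simp [glueWord]⟩)
  have h2 : occurrences (some (Sum.inl a))
      (A₁.map (some ∘ Sum.inl) ++ none :: A₂.map (some ∘ Sum.inl)) ≤ 1 :=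
    h.occurrences_le_one ⟨B₁.map (some ∘ Sum.inr), B₂.map (some ∘ Sum.inr) ++
      none :: L.flatMap glueBlock, by simp [glueWord]⟩ (by simp)
  rw [glueWord, occurrences_append, hR, occurrences_append,
    occurrences_append _ (B₂.map _), hR, occurrences_cons, if_neg (by simp)]
  omega

/-- Gluing two `k`-representable graphs in a vertex, `k ≥ 2`, preserves `k`-representability. -/
theorem kRepresentable_glue {H₁ : SimpleGraph (Option α)} {H₂ : SimpleGraph (Option β)}
    {G : SimpleGraph (Option (α ⊕ β))} {k : ℕ} (hk : 2 ≤ k)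
    (h₁ : KRepresentable H₁ k) (h₂ : KRepresentable H₂ k)
    (hl : ∀ v v' : Option α, G.Adj (v.map Sum.inl) (v'.map Sum.inl) ↔ H₁.Adj v v')
    (hr : ∀ v v' : Option β, G.Adj (v.map Sum.inr) (v'.map Sum.inr) ↔ H₂.Adj v v')
    (hlr : ∀ a b, ¬ G.Adj (some (Sum.inl a)) (some (Sum.inr b))) :
    KRepresentable G k := by
  obtain ⟨As, hlenA, hkA, hwA⟩ := h₁.exists_blocks
  obtain ⟨Bs, hlenB, hkB, hwB⟩ := h₂.exists_blocks
  obtain ⟨A₁, A₂, As, rfl⟩ : ∃ A₁ A₂ As', As = A₁ :: A₂ :: As' := by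
    match As, hlenA with
    | [], h => simp at h; omega
    | [_], h => simp at h; omega
    | A₁ :: A₂ :: As, _ => exact ⟨A₁, A₂, As, rfl⟩
  obtain ⟨B₁, B₂, Bs, rfl⟩ : ∃ B₁ B₂ Bs', Bs = B₁ :: B₂ :: Bs' := by
    match Bs, hlenB with
    | [], h => simp at h; omega
    | [_], h => simp at h; omega
    | B₁ :: B₂ :: Bs, _ => exact ⟨B₁, B₂, Bs, rfl⟩
  simp only [List.length_cons] at hlenA hlenB
  have hA : (As.zip Bs).map Prod.fst = As := List.map_fst_zip (by omega)
  have hB : (As.zip Bs).map Prod.snd = Bs := List.map_snd_zip (by omega)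
  have hlen : (As.zip Bs).length = k - 2 := by rw [List.length_zip]; omega
  generalize As.zip Bs = L at hA hB hlen
  subst hA hB
  rw [← filterMap_leftPart_glueWord A₁ A₂ B₁ B₂ L] at hkA hwA
  rw [← filterMap_rightPart_glueWord A₁ A₂ B₁ B₂ L] at hkB hwB
  generalize hw : glueWord A₁ A₂ B₁ B₂ L = w at hkA hwA hkB hwB
  have hcl (v : Option α) : occurrences (v.map Sum.inl) w = k := by
    rw [← occurrences_filterMap leftPart_eq_some]; exact hkA v
  have hcr (v : Option β) : occurrences (v.map Sum.inr) w = k := by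
    rw [← occurrences_filterMap rightPart_eq_some]; exact hkB v
  have hal {v v' : Option α} (hv : v ≠ v') :
      Alternate w (v.map Sum.inl) (v'.map Sum.inl) ↔ G.Adj (v.map Sum.inl) (v'.map Sum.inl) := by
    rw [← alternate_filterMap leftPart_eq_some, hwA.2 _ _ hv, hl]
  have har {v v' : Option β} (hv : v ≠ v') :
      Alternate w (v.map Sum.inr) (v'.map Sum.inr) ↔ G.Adj (v.map Sum.inr) (v'.map Sum.inr) := by
    rw [← alternate_filterMap rightPart_eq_some, hwB.2 _ _ hv, hr]
  have hac (a : α) (b : β) : ¬ Alternate w (some (Sum.inl a)) (some (Sum.inr b)) := by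
    intro h
    have h1 := hcl (some a)
    subst hw
    have h2 := occurrences_inl_glueWord_le h
    rw [Option.map_some] at h1
    omega
  have hku : KUniform k w := by
    rintro (_ | a | b)
    · exact hcl none
    · exact hcl (some a)
    · exact hcr (some b)
  refine ⟨w, hku, fun v => mem_of_occurrences_pos (by rw [kUniform_iff_occurrences.1 hku v]; omega), ?_⟩
  rintro (_ | a | b) (_ | a' | b') hne
  · exact absurd rfl hne
  · exact hal (v := none) (v' := some a') (by simp)
  · exact har (v := none) (v' := some b') (by simp)
  · exact hal (v := some a) (v' := none) (by simp)
  · exact hal (v := some a) (v' := some a') (by simpa using hne)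
  · exact iff_of_false (hac a b') (hlr a b')
  · exact har (v := some b) (v' := none) (by simp)
  · exact iff_of_false (fun h => hac a' b (alternate_comm.1 h)) (fun h => hlr a' b h.symm)
  · exact har (v := some b) (v' := some b') (by simpa using hne)

end Glue

/-- Gluing two word-representable graphs `G1`, `G2` (each with at least two vertices,
with representation numbers `k1` and `k2`) in a vertex, identifying `x ∈ V1` and `y ∈ V2`
into a single new vertex `z`, yields a word-representable graph with representation
number `max (max k1 k2) 2`. The glued graph `G''` lives on
`Option ({a // a ≠ x} ⊕ {b // b ≠ y})`, the new vertex `z` being `none`. -/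
theorem reprNum_glue_in_vertex {V1 V2 : Type*} [DecidableEq V1] [DecidableEq V2]
    [Fintype V1] [Fintype V2]
    (G1 : SimpleGraph V1) (G2 : SimpleGraph V2)
    (hcard1 : 2 ≤ Fintype.card V1) (hcard2 : 2 ≤ Fintype.card V2)
    (hw1 : WordRepresentable G1) (hw2 : WordRepresentable G2)
    (k1 k2 : ℕ) (hk1 : reprNum G1 = k1) (hk2 : reprNum G2 = k2)
    (x : V1) (y : V2)
    (G'' : SimpleGraph (Option ({a : V1 // a ≠ x} ⊕ {b : V2 // b ≠ y})))
    (hll : ∀ a b : {a : V1 // a ≠ x},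
      G''.Adj (some (Sum.inl a)) (some (Sum.inl b)) ↔ G1.Adj a b)
    (hrr : ∀ a b : {b : V2 // b ≠ y},
      G''.Adj (some (Sum.inr a)) (some (Sum.inr b)) ↔ G2.Adj a b)
    (hlr : ∀ (a : {a : V1 // a ≠ x}) (b : {b : V2 // b ≠ y}),
      ¬ G''.Adj (some (Sum.inl a)) (some (Sum.inr b)))
    (hzl : ∀ a : {a : V1 // a ≠ x}, G''.Adj none (some (Sum.inl a)) ↔ G1.Adj x a)
    (hzr : ∀ b : {b : V2 // b ≠ y}, G''.Adj none (some (Sum.inr b)) ↔ G2.Adj y b) :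
    WordRepresentable G'' ∧ reprNum G'' = max (max k1 k2) 2 := by
  have hl : ∀ v v' : Option {a : V1 // a ≠ x}, G''.Adj (v.map Sum.inl) (v'.map Sum.inl) ↔
      (G1.comap (Equiv.optionSubtypeNe x)).Adj v v' := by
    rintro (_ | a) (_ | a')
    · simp
    · simpa using hzl a'
    · simpa [SimpleGraph.adj_comm] using hzl a
    · simpa using hll a a'
  have hr : ∀ v v' : Option {b : V2 // b ≠ y}, G''.Adj (v.map Sum.inr) (v'.map Sum.inr) ↔
      (G2.comap (Equiv.optionSubtypeNe y)).Adj v v' := by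
    rintro (_ | b) (_ | b')
    · simp
    · simpa using hzr b'
    · simpa [SimpleGraph.adj_comm] using hzr b
    · simpa using hrr b b'
  let e1 := SimpleGraph.Iso.comap (Equiv.optionSubtypeNe x) G1
  let e2 := SimpleGraph.Iso.comap (Equiv.optionSubtypeNe y) G2
  let f1 : G1.comap (Equiv.optionSubtypeNe x) ↪g G'' :=
    ⟨⟨Option.map Sum.inl, Option.map_injective Sum.inl_injective⟩, hl _ _⟩
  let f2 : G2.comap (Equiv.optionSubtypeNe y) ↪g G'' :=
    ⟨⟨Option.map Sum.inr, Option.map_injective Sum.inr_injective⟩, hr _ _⟩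
  have hr1 : KRepresentable G1 k1 := hk1 ▸ kRepresentable_reprNum hw1
  have hr2 : KRepresentable G2 k2 := hk2 ▸ kRepresentable_reprNum hw2
  have hG : KRepresentable G'' (max (max k1 k2) 2) :=
    kRepresentable_glue (le_max_right _ _)
      ((hr1.mono (by omega)).of_embedding e1.toEmbedding)
      ((hr2.mono (by omega)).of_embedding e2.toEmbedding) hl hr hlr
  obtain ⟨w, -, hw⟩ := id hG
  refine ⟨⟨w, hw⟩, le_antisymm (Nat.sInf_le hG) ?_⟩
  have hmin := kRepresentable_reprNum (G := G'') ⟨w, hw⟩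
  have hle1 : k1 ≤ reprNum G'' := hk1 ▸ Nat.sInf_le
    ((hmin.of_embedding f1).of_embedding e1.symm.toEmbedding)
  have hle2 : k2 ≤ reprNum G'' := hk2 ▸ Nat.sInf_le
    ((hmin.of_embedding f2).of_embedding e2.symm.toEmbedding)
  obtain ⟨a, ha⟩ := Fintype.exists_ne_of_one_lt_card hcard1 x
  obtain ⟨b, hb⟩ := Fintype.exists_ne_of_one_lt_card hcard2 y
  have hle := two_le_of_kRepresentable hmin (a := some (Sum.inl ⟨a, ha⟩))
    (b := some (Sum.inr ⟨b, hb⟩)) (by simp) (hlr _ _)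
  exact max_le (max_le hle1 hle2) hle
end
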